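/- arXiv:2510.26039 — 3 statements merged into one kernel-verified Lean document; each statement's English description precedes it below -/
import Mathlib

section
/- Let q, λ > 0 and let W_q, W_{q+λ} : ℝ → ℝ vanish on (−∞, 0) and be continuous and locally integrable on [0, ∞). Assume that λ ∫₀^x W_{q+λ}(x − u) W_q(u) du = W_{q+λ}(x) − W_q(x) for all x ≥ 0. For a < b and x, y ∈ ℝ define 𝒲_b(x, y) := W_{q+λ}(x − y) − λ ∫_b^x W_q(x − z) W_{q+λ}(z − y) dz. Then for every integrable function h : [a, b] → ℝ and all a < b < c, ∫_b^c W_{q+λ}(c − y) (∫_a^b h(z) 𝒲_b(y, z) dz) dy = ∫_a^b h(z) (∫_b^c W_q(c − y) W_{q+λ}(y − z) dy) dz. -/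
open MeasureTheory Filter Set Real

/-- Dirichlet's formula: exchanging the order of integration over a triangle. -/
theorem intervalIntegral_triangle_swap {f : ℝ → ℝ → ℝ} (hf : Continuous (Function.uncurry f))
    {b c : ℝ} (hbc : b ≤ c) :
    (∫ y in b..c, ∫ u in b..y, f y u) = ∫ u in b..c, ∫ y in u..c, f y u := by
  have hT : MeasurableSet {p : ℝ × ℝ | p.2 ≤ p.1} :=
    measurableSet_le measurable_snd measurable_fst
  have hint : Integrable (Function.uncurry fun y u => (Iic y).indicator (f y) u)
      ((volume.restrict (Ioc b c)).prod (volume.restrict (Ioc b c))) := by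
    have h1 : IntegrableOn (Function.uncurry f) (Ioc b c ×ˢ Ioc b c) (volume.prod volume) :=
      (hf.continuousOn.integrableOn_compact (isCompact_Icc.prod isCompact_Icc)).mono_set
        (prod_mono Ioc_subset_Icc_self Ioc_subset_Icc_self)
    rw [Measure.prod_restrict]
    exact h1.integrable.indicator hT
  have hswap := integral_integral_swap hint
  rw [intervalIntegral.integral_of_le hbc, intervalIntegral.integral_of_le hbc]
  convert hswap using 1
  · refine setIntegral_congr_fun measurableSet_Ioc fun y hy => ?_
    have : Ioc b c ∩ Iic y = Ioc b y := by
      rw [Ioc_inter_Iic, min_eq_right hy.2]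
    rw [intervalIntegral.integral_of_le hy.1.le, setIntegral_indicator measurableSet_Iic, this]
  · refine setIntegral_congr_fun measurableSet_Ioc fun u hu => ?_
    have : Ioc b c ∩ Ici u = Icc u c := by
      ext y
      simp only [mem_inter_iff, mem_Ioc, mem_Ici, mem_Icc]
      exact ⟨fun h => ⟨h.2, h.1.2⟩, fun h => ⟨⟨hu.1.trans_le h.1, h.2⟩, h.1⟩⟩
    have hind : (fun y => (Iic y).indicator (f y) u) = (Ici u).indicator fun y => f y u := by
      ext y
      simp [indicator_apply]
    rw [hind, intervalIntegral.integral_of_le hu.2, setIntegral_indicator measurableSet_Ici, this,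
      integral_Icc_eq_integral_Ioc]

/-- Fubini's theorem for a continuous kernel integrated against an integrable weight. -/
theorem intervalIntegral_swap_of_continuous_kernel {h : ℝ → ℝ} {K : ℝ → ℝ → ℝ}
    (hK : Continuous (Function.uncurry K)) {a b c d : ℝ} (hab : a ≤ b) (hcd : c ≤ d)
    (hh : IntegrableOn h (Icc a b)) :
    (∫ y in c..d, ∫ z in a..b, h z * K y z) = ∫ z in a..b, h z * ∫ y in c..d, K y z := by
  obtain ⟨C, hC⟩ := ((isCompact_Icc (a := c) (b := d)).prod
    (isCompact_Icc (a := a) (b := b))).exists_bound_of_continuousOn hK.continuousOn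
  have hint : Integrable (Function.uncurry fun y z => h z * K y z)
      ((volume.restrict (Ioc c d)).prod (volume.restrict (Ioc a b))) := by
    refine Integrable.mul_bdd (c := C)
      (Integrable.comp_snd (hh.mono_set Ioc_subset_Icc_self).integrable _)
      hK.aestronglyMeasurable ?_
    rw [Measure.prod_restrict]
    exact ae_restrict_of_forall_mem (measurableSet_Ioc.prod measurableSet_Ioc) fun p hp =>
      hC p (prod_mono Ioc_subset_Icc_self Ioc_subset_Icc_self hp)
  have hswap := integral_integral_swap hint
  simp only [intervalIntegral.integral_of_le hab, intervalIntegral.integral_of_le hcd]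
  rw [hswap]
  simp only [integral_const_mul]

/-- If `lam * (G ∗ F) = G - F` on `[0, ∞)`, then integrating `G (c - ·)` against
`G (· - z) - lam * ∫ u in b..·, F (· - u) * G (u - z)` replaces the outer `G` by `F`. -/
theorem integral_mul_sub_resolvent {F G : ℝ → ℝ} (hF : Continuous F) (hG : Continuous G)
    {lam : ℝ} (hFG : ∀ x : ℝ, 0 ≤ x → lam * (∫ u in (0 : ℝ)..x, G (x - u) * F u) = G x - F x)
    {b c : ℝ} (hbc : b ≤ c) (z : ℝ) :
    (∫ y in b..c, G (c - y) * (G (y - z) - lam * ∫ u in b..y, F (y - u) * G (u - z))) =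
      ∫ y in b..c, F (c - y) * G (y - z) := by
  have hI : Continuous fun y => ∫ u in b..y, F (y - u) * G (u - z) :=
    intervalIntegral.continuous_parametric_intervalIntegral_of_continuous
      (f := fun y u => F (y - u) * G (u - z)) (by fun_prop) continuous_id
  have hswap := intervalIntegral_triangle_swap
    (f := fun y u => lam * (G (c - y) * (F (y - u) * G (u - z)))) (by fun_prop) hbc
  have hinner : ∀ u ∈ uIcc b c, (∫ y in u..c, lam * (G (c - y) * (F (y - u) * G (u - z)))) =
      (G (c - u) - F (c - u)) * G (u - z) := by
    intro u hu
    rw [uIcc_of_le hbc] at hu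
    have hs := intervalIntegral.integral_comp_sub_right
      (fun v => G (c - u - v) * F v) u (a := u) (b := c)
    rw [sub_self] at hs
    rw [← hFG (c - u) (sub_nonneg.2 hu.2), ← hs, ← intervalIntegral.integral_const_mul,
      ← intervalIntegral.integral_mul_const]
    congr 1
    ext y
    rw [show c - u - (y - u) = c - y by ring]
    ring
  rw [intervalIntegral.integral_congr hinner] at hswap
  have hleft : (∫ y in b..c, G (c - y) *
      (G (y - z) - lam * ∫ u in b..y, F (y - u) * G (u - z))) =
      (∫ y in b..c, G (c - y) * G (y - z)) -
        ∫ y in b..c, ∫ u in b..y, lam * (G (c - y) * (F (y - u) * G (u - z))) := by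
    simp only [intervalIntegral.integral_const_mul]
    rw [← intervalIntegral.integral_const_mul, ← intervalIntegral.integral_sub]
    · congr 1
      ext y
      ring
    · exact Continuous.intervalIntegrable (by fun_prop) _ _
    · exact Continuous.intervalIntegrable (by fun_prop) _ _
  rw [hleft, hswap, ← intervalIntegral.integral_sub]
  · congr 1
    ext y
    ring
  · exact Continuous.intervalIntegrable (by fun_prop) _ _
  · exact Continuous.intervalIntegrable (by fun_prop) _ _

/-- Identity (P1 misc 3) of the paper:
`∫_b^c W_{q+λ}(c - y) (∫_a^b h(z) 𝒲_b(y, z) dz) dy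
  = ∫_a^b h(z) (∫_b^c W_q(c - y) W_{q+λ}(y - z) dy) dz` for `a < b < c`. -/
theorem Wscr_integral_identity
    (q lam : ℝ) (hq : 0 < q) (hlam : 0 < lam)
    (Wq Wql : ℝ → ℝ)
    (hWq0 : ∀ x < (0:ℝ), Wq x = 0) (hWql0 : ∀ x < (0:ℝ), Wql x = 0)
    (hWqc : ContinuousOn Wq (Set.Ici 0)) (hWqlc : ContinuousOn Wql (Set.Ici 0))
    (hWqi : LocallyIntegrableOn Wq (Set.Ici 0))
    (hWqli : LocallyIntegrableOn Wql (Set.Ici 0))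
    (hconvW : ∀ x : ℝ, 0 ≤ x →
      lam * (∫ u in (0:ℝ)..x, Wql (x - u) * Wq u) = Wql x - Wq x)
    (Ws : ℝ → ℝ → ℝ → ℝ)
    (hWs : ∀ b x y : ℝ, Ws b x y =
      Wql (x - y) - lam * ∫ z in b..x, Wq (x - z) * Wql (z - y)) :
    ∀ (h : ℝ → ℝ) (a b c : ℝ), a < b → b < c → IntegrableOn h (Set.Icc a b) →
      (∫ y in b..c, Wql (c - y) * (∫ z in a..b, h z * Ws b y z)) =
        ∫ z in a..b, h z * (∫ y in b..c, Wq (c - y) * Wql (y - z)) := by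
  intro h a b c hab hbc hh
  set F : ℝ → ℝ := fun x => Wq (max x 0) with hF_def
  set G : ℝ → ℝ := fun x => Wql (max x 0) with hG_def
  have hF : Continuous F :=
    hWqc.comp_continuous (by fun_prop) fun x => le_max_right x 0
  have hG : Continuous G :=
    hWqlc.comp_continuous (by fun_prop) fun x => le_max_right x 0
  have hFe : ∀ x, 0 ≤ x → Wq x = F x := fun x hx => by simp [hF_def, max_eq_left hx]
  have hGe : ∀ x, 0 ≤ x → Wql x = G x := fun x hx => by simp [hG_def, max_eq_left hx]
  have hFG : ∀ x : ℝ, 0 ≤ x →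
      lam * (∫ u in (0 : ℝ)..x, G (x - u) * F u) = G x - F x := by
    intro x hx
    rw [← hFe x hx, ← hGe x hx, ← hconvW x hx]
    congr 1
    refine intervalIntegral.integral_congr fun u hu => ?_
    rw [uIcc_of_le hx] at hu
    rw [hGe _ (sub_nonneg.2 hu.2), hFe _ hu.1]
  set K : ℝ → ℝ → ℝ := fun y z =>
    G (c - y) * (G (y - z) - lam * ∫ u in b..y, F (y - u) * G (u - z)) with hK_def
  have hK : Continuous (Function.uncurry K) := by
    have hI : Continuous fun p : ℝ × ℝ => ∫ u in b..p.1, F (p.1 - u) * G (u - p.2) :=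
      intervalIntegral.continuous_parametric_intervalIntegral_of_continuous
        (f := fun (p : ℝ × ℝ) u => F (p.1 - u) * G (u - p.2)) (by fun_prop) continuous_fst
    simp only [hK_def, Function.uncurry_def]
    fun_prop
  have hWsK : ∀ y ∈ Icc b c, ∀ z ∈ Icc a b, Wql (c - y) * Ws b y z = K y z := by
    intro y hy z hz
    rw [hWs, hGe _ (sub_nonneg.2 hy.2), hGe _ (sub_nonneg.2 (hz.2.trans hy.1)), hK_def]
    congr 3
    refine intervalIntegral.integral_congr fun u hu => ?_
    rw [uIcc_of_le hy.1] at hu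
    rw [hFe _ (sub_nonneg.2 hu.2), hGe _ (sub_nonneg.2 (hz.2.trans hu.1))]
  calc (∫ y in b..c, Wql (c - y) * (∫ z in a..b, h z * Ws b y z))
      = ∫ y in b..c, ∫ z in a..b, h z * K y z := by
        refine intervalIntegral.integral_congr fun y hy => ?_
        rw [uIcc_of_le hbc.le] at hy
        rw [← intervalIntegral.integral_const_mul]
        refine intervalIntegral.integral_congr fun z hz => ?_
        rw [uIcc_of_le hab.le] at hz
        rw [← hWsK y hy z hz]
        ring
    _ = ∫ z in a..b, h z * ∫ y in b..c, K y z :=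
        intervalIntegral_swap_of_continuous_kernel hK hab.le hbc.le hh
    _ = ∫ z in a..b, h z * (∫ y in b..c, Wq (c - y) * Wql (y - z)) := by
        refine intervalIntegral.integral_congr fun z hz => ?_
        rw [uIcc_of_le hab.le] at hz
        simp only [hK_def]
        rw [integral_mul_sub_resolvent hF hG hFG hbc.le z]
        congr 1
        refine intervalIntegral.integral_congr fun y hy => ?_
        rw [uIcc_of_le hbc.le] at hy
        rw [hFe _ (sub_nonneg.2 hy.2), hGe _ (sub_nonneg.2 (hz.2.trans hy.1))]
end

section
/- Let q, λ > 0 and Φ_q > 0. Let W_q, W_{q+λ} : ℝ → ℝ vanish on (−∞, 0), be nonnegative, non-decreasing, continuous and locally integrable on [0, ∞), with W_q strictly positive on (0, ∞); set Z_q(x) := 1 + q ∫₀^{max(x,0)} W_q(y) dy and Z_{q+λ}(x) := 1 + (q+λ) ∫₀^{max(x,0)} W_{q+λ}(y) dy. Assume that for every x ∈ ℝ, W_q(y + x)/W_q(y) → e^{Φ_q x} as y → ∞, and that W_q(y)/Z_q(y) → Φ_q/q as y → ∞. For a < b and x ∈ ℝ set 𝒵_b(x, a) := Z_q(x − a) +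 λ ∫_a^b W_q(x − u) Z_{q+λ}(u − a) du and 𝒦_b(x, a) := (1/(λ+q)) ( q 𝒵_b(x, a)/Z_{q+λ}(b − a) + λ Z_q(x − b) ), and define Θ(x) := 1 + λ ∫₀^x e^{−Φ_q y} W_{q+λ}(y) dy. Then for all a < b, lim_{c→∞} 𝒦_b(c, a)/Z_q(c − a) = Θ(b − a)/Z_{q+λ}(b − a). -/
open MeasureTheory Filter Set Real

/-- Extending a function that is continuous on `[0, ∞)` by its value at `0` gives a continuous
function. -/
lemma continuous_comp_max_zero {g : ℝ → ℝ} (hg : ContinuousOn g (Ici 0)) :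
    Continuous fun t => g (max t 0) :=
  hg.comp_continuous (by fun_prop) fun t => le_max_right t 0

lemma integral_comp_max_zero (h g : ℝ → ℝ) {x : ℝ} (hx : 0 ≤ x) :
    ∫ y in (0:ℝ)..x, h y * g (max y 0) = ∫ y in (0:ℝ)..x, h y * g y := by
  refine intervalIntegral.integral_congr fun y hy => ?_
  rw [uIcc_of_le hx] at hy
  simp only [max_eq_left hy.1]

/-- Integration by parts of an exponential against an antiderivative. -/
lemma mul_integral_exp_mul_antideriv {g : ℝ → ℝ} (hg : Continuous g) (k p L : ℝ) :
    p * ∫ t in (0:ℝ)..L, exp (-p * t) * (1 + k * ∫ y in (0:ℝ)..t, g y) =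
      1 - exp (-p * L) * (1 + k * ∫ y in (0:ℝ)..L, g y) +
        k * ∫ t in (0:ℝ)..L, exp (-p * t) * g t := by
  have hG : ∀ t, HasDerivAt (fun t => ∫ y in (0:ℝ)..t, g y) (g t) t := fun t =>
    intervalIntegral.integral_hasDerivAt_right (hg.intervalIntegrable _ _)
      (hg.stronglyMeasurableAtFilter _ _) hg.continuousAt
  have hGc : Continuous fun t => ∫ y in (0:ℝ)..t, g y :=
    continuous_iff_continuousAt.2 fun t => (hG t).continuousAt
  have hF : ∀ t, HasDerivAt (fun t => -(exp (-p * t) * (1 + k * ∫ y in (0:ℝ)..t, g y)))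
      (p * (exp (-p * t) * (1 + k * ∫ y in (0:ℝ)..t, g y)) - k * (exp (-p * t) * g t)) t := by
    intro t
    have h1 : HasDerivAt (fun t => exp (-p * t)) (exp (-p * t) * (-p * 1)) t :=
      ((hasDerivAt_id t).const_mul (-p)).exp
    exact (h1.fun_mul (((hG t).const_mul k).const_add 1)).fun_neg.congr_deriv (by ring)
  have hi1 : IntervalIntegrable
      (fun t => p * (exp (-p * t) * (1 + k * ∫ y in (0:ℝ)..t, g y))) volume 0 L :=
    Continuous.intervalIntegrable (by fun_prop) _ _
  have hi2 : IntervalIntegrable (fun t => k * (exp (-p * t) * g t)) volume 0 L :=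
    Continuous.intervalIntegrable (by fun_prop) _ _
  have key := intervalIntegral.integral_eq_sub_of_hasDerivAt (fun t _ => hF t) (hi1.sub hi2)
  rw [intervalIntegral.integral_sub hi1 hi2, intervalIntegral.integral_const_mul,
    intervalIntegral.integral_const_mul] at key
  simp only [mul_zero, exp_zero, intervalIntegral.integral_same, add_zero, mul_one] at key
  linarith

/-- If `W (y + x) / W y → exp (p * x)` and `W / Z → r`, then integrals of translates of `W` against
a continuous function, normalised by `Z`, converge to exponential integrals. -/
lemma tendsto_integral_translate_div {W Z h : ℝ → ℝ} {p r a b : ℝ} (hab : a ≤ b)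
    (hWnn : ∀ x, 0 ≤ x → 0 ≤ W x) (hWmono : MonotoneOn W (Ici 0)) (hWc : ContinuousOn W (Ici 0))
    (hZ : ∀ x, 0 < Z x) (hh : Continuous h)
    (hlim : ∀ x, Tendsto (fun y => W (y + x) / Z y) atTop (nhds (r * exp (p * x)))) :
    Tendsto (fun c => (∫ u in a..b, W (c - u) * h (u - a)) / Z (c - a)) atTop
      (nhds (r * ∫ t in (0:ℝ)..(b - a), exp (-p * t) * h t)) := by
  have hsub : r * ∫ t in (0:ℝ)..(b - a), exp (-p * t) * h t =
      ∫ u in a..b, r * exp (-p * (u - a)) * h (u - a) := by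
    rw [intervalIntegral.integral_comp_sub_right (fun t => r * exp (-p * t) * h t) a, sub_self,
      ← intervalIntegral.integral_const_mul]
    simp only [mul_assoc]
  have hshift : Tendsto (fun c : ℝ => c - a) atTop atTop :=
    tendsto_atTop_add_const_right _ (-a) tendsto_id
  have hbd : ∀ᶠ c in atTop, W (c - a) / Z (c - a) ≤ r + 1 := by
    have h0 := (hlim 0).comp hshift
    simp only [mul_zero, exp_zero, mul_one, add_zero, Function.comp_def] at h0
    exact h0.eventually_le_const (lt_add_one r)
  simp_rw [hsub, ← intervalIntegral.integral_div]
  refine intervalIntegral.tendsto_integral_filter_of_dominated_convergence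
    (fun u => (r + 1) * |h (u - a)|) ?_ ?_ ?_ ?_
  · filter_upwards [eventually_ge_atTop b] with c hc
    refine ContinuousOn.aestronglyMeasurable ?_ measurableSet_uIoc
    rw [uIoc_of_le hab]
    refine ((hWc.comp (by fun_prop) fun u hu => ?_).mul (by fun_prop)).div_const _
    exact sub_nonneg.2 (hu.2.trans hc)
  · filter_upwards [eventually_ge_atTop b, hbd] with c hc hcb
    refine Eventually.of_forall fun u hu => ?_
    rw [uIoc_of_le hab] at hu
    have h1 : 0 ≤ c - u := sub_nonneg.2 (hu.2.trans hc)
    have h2 : W (c - u) ≤ W (c - a) :=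
      hWmono h1 (mem_Ici.2 (by linarith [hu.1])) (by linarith [hu.1])
    rw [mul_div_right_comm, norm_mul, norm_eq_abs, norm_eq_abs,
      abs_of_nonneg (div_nonneg (hWnn _ h1) (hZ _).le)]
    gcongr
    exact (div_le_div_of_nonneg_right h2 (hZ _).le).trans hcb
  · exact Continuous.intervalIntegrable (by fun_prop) _ _
  · refine Eventually.of_forall fun u _ => ?_
    have h1 := ((hlim (-(u - a))).comp hshift).mul_const (h (u - a))
    simp only [Function.comp_def] at h1
    convert h1 using 2 with c
    · rw [mul_div_right_comm]
      congr 3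
      ring
    · rw [mul_neg, neg_mul]

/-- Lemma B.2 (display (control misc 1)) of the paper:
`lim_{c→∞} 𝒦_b(c, a)/Z_q(c - a) = Θ(b - a)/Z_{q+λ}(b - a)`. -/
theorem K_over_Z_limit
    (q lam Phiq : ℝ) (hq : 0 < q) (hlam : 0 < lam) (hPhiq : 0 < Phiq)
    (Wq Wql : ℝ → ℝ)
    (hWq0 : ∀ x < (0:ℝ), Wq x = 0) (hWql0 : ∀ x < (0:ℝ), Wql x = 0)
    (hWqnn : ∀ x : ℝ, 0 ≤ x → 0 ≤ Wq x) (hWqlnn : ∀ x : ℝ, 0 ≤ x → 0 ≤ Wql x)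
    (hWqmono : MonotoneOn Wq (Set.Ici 0)) (hWqlmono : MonotoneOn Wql (Set.Ici 0))
    (hWqc : ContinuousOn Wq (Set.Ici 0)) (hWqlc : ContinuousOn Wql (Set.Ici 0))
    (hWqi : LocallyIntegrableOn Wq (Set.Ici 0))
    (hWqli : LocallyIntegrableOn Wql (Set.Ici 0))
    (hWqpos : ∀ x : ℝ, 0 < x → 0 < Wq x)
    (Zq Zql : ℝ → ℝ)
    (hZq : ∀ x : ℝ, Zq x = 1 + q * ∫ y in (0:ℝ)..(max x 0), Wq y)
    (hZql : ∀ x : ℝ, Zql x = 1 + (q + lam) * ∫ y in (0:ℝ)..(max x 0), Wql y)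
    (hlim1 : ∀ x : ℝ, Filter.Tendsto (fun y => Wq (y + x) / Wq y) Filter.atTop
      (nhds (Real.exp (Phiq * x))))
    (hlim2 : Filter.Tendsto (fun y => Wq y / Zq y) Filter.atTop (nhds (Phiq / q)))
    (a b : ℝ) (hab : a < b)
    (Zs : ℝ → ℝ) (hZs : ∀ x : ℝ, Zs x =
      Zq (x - a) + lam * ∫ u in a..b, Wq (x - u) * Zql (u - a))
    (K : ℝ → ℝ) (hK : ∀ x : ℝ, K x =
      (1 / (lam + q)) * (q * Zs x / Zql (b - a) + lam * Zq (x - b)))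
    (Θ : ℝ → ℝ) (hΘ : ∀ x : ℝ, Θ x =
      1 + lam * ∫ y in (0:ℝ)..x, Real.exp (-Phiq * y) * Wql y) :
    Filter.Tendsto (fun c => K c / Zq (c - a)) Filter.atTop
      (nhds (Θ (b - a) / Zql (b - a))) := by
  have hZqpos : ∀ x, 0 < Zq x := fun x => by
    rw [hZq]
    have := intervalIntegral.integral_nonneg (μ := volume) (le_max_right x 0)
      fun y hy => hWqnn y hy.1
    positivity
  have hZqlpos : ∀ x, 0 < Zql x := fun x => by
    rw [hZql]
    have := intervalIntegral.integral_nonneg (μ := volume) (le_max_right x 0)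
      fun y hy => hWqlnn y hy.1
    positivity
  have hgc := continuous_comp_max_zero hWqlc
  have hZqlg : ∀ x, Zql x =
      1 + (q + lam) * ∫ y in (0:ℝ)..(max x 0), Wql (max y 0) := fun x => by
    have := integral_comp_max_zero (fun _ => 1) Wql (le_max_right x 0)
    simp only [one_mul] at this
    rw [hZql, this]
  have hZqlc : Continuous Zql := by
    rw [funext hZqlg]
    have := (intervalIntegral.continuous_primitive (μ := volume)
      (fun c d => hgc.intervalIntegrable c d) 0).comp
      (continuous_id.max continuous_const : Continuous fun x : ℝ => max x 0)
    exact continuous_const.add (continuous_const.mul this)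
  have hlim : ∀ x, Tendsto (fun y => Wq (y + x) / Zq y) atTop
      (nhds (Phiq / q * exp (Phiq * x))) := fun x => by
    rw [mul_comm]
    refine ((hlim1 x).mul hlim2).congr' ?_
    filter_upwards [eventually_gt_atTop 0] with y hy
    exact div_mul_div_cancel₀ (hWqpos y hy).ne'
  have hL : 0 ≤ b - a := (sub_pos.2 hab).le
  have hint := tendsto_integral_translate_div hab.le hWqnn hWqmono hWqc hZqpos hZqlc hlim
  have hparts : Phiq * ∫ t in (0:ℝ)..(b - a), exp (-Phiq * t) * Zql t =
      1 - exp (-Phiq * (b - a)) * Zql (b - a) +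
        (q + lam) * ∫ t in (0:ℝ)..(b - a), exp (-Phiq * t) * Wql t := by
    have h1 := mul_integral_exp_mul_antideriv hgc (q + lam) Phiq (b - a)
    rw [integral_comp_max_zero (fun t => exp (-Phiq * t)) Wql hL] at h1
    rw [hZqlg (b - a), max_eq_left hL, ← h1]
    congr 1
    refine intervalIntegral.integral_congr fun t ht => ?_
    rw [uIcc_of_le hL] at ht
    simp only [hZqlg t, max_eq_left ht.1]
  have hshift : ∀ d : ℝ, Tendsto (fun c : ℝ => c - d) atTop atTop := fun d =>
    tendsto_atTop_add_const_right _ (-d) tendsto_id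
  have hratio : Tendsto (fun c => Zq (c - b) / Zq (c - a)) atTop
      (nhds (exp (-Phiq * (b - a)))) := by
    have h1 := ((hlim (-(b - a))).comp (hshift a)).div (hlim2.comp (hshift b)) (by positivity)
    rw [mul_div_cancel_left₀ _ (by positivity : Phiq / q ≠ 0), mul_neg, ← neg_mul] at h1
    refine h1.congr' ?_
    filter_upwards [eventually_gt_atTop b] with c hc
    have h2 := (hWqpos (c - b) (sub_pos.2 hc)).ne'
    have h3 := (hZqpos (c - a)).ne'
    have h4 := (hZqpos (c - b)).ne'
    simp only [Pi.div_apply, Function.comp_apply]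
    rw [show c - a + -(b - a) = c - b by ring]
    field_simp
  have hmain := ((((hint.const_mul lam).const_add 1).const_mul (q / Zql (b - a))).add
    (hratio.const_mul lam)).const_mul (1 / (lam + q))
  have hZL := (hZqlpos (b - a)).ne'
  have hlq : lam + q ≠ 0 := by positivity
  convert hmain using 2 with c
  · have := (hZqpos (c - a)).ne'
    rw [hK, hZs]
    field_simp
  · rw [div_mul_eq_mul_div Phiq q, hparts, hΘ]
    field_simp
    ring
end

section
/- Under the standing hypotheses on q, λ, Φ_q, Φ_{q+λ}, W, f, K_c, K_p listed in the context, the quantities ā₁ := inf{a ∈ ℝ : Γ₁(a) ≥ 0} and ā₂ := inf{a ∈ ℝ : Γ₂(a) ≥ 0} satisfy ā₁ ∈ (−∞, ā̄) and ā₂ ∈ (−∞, ā); in particular both infima are finite. -/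
open MeasureTheory Filter Set Real

noncomputable section

/-- Tilted inventory-cost derivative integrand against the scale function:
`ρ_a(b) = ∫_a^b g(y) W(b - y) dy`. -/
def rho (W g : ℝ → ℝ) (a b : ℝ) : ℝ :=
  ∫ y in a..b, g y * W (b - y)

/-- `Γ(a, b)` of the paper (display (Gamma)). -/
def Gam (lam Phiq Kp Kc : ℝ) (W g : ℝ → ℝ) (a b : ℝ) : ℝ :=
  (∫ y in Set.Ioi (0:ℝ), Real.exp (-Phiq * y) * g (y + a)) +
    lam * (∫ y in (0:ℝ)..(b - a), Real.exp (-Phiq * y) * rho W g a (y + a)) +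
    lam / Phiq * Real.exp (-Phiq * (b - a)) * (Kp - Kc)

/-- `Γ₁(a) = Γ(a, a+)`. -/
def Gam1 (lam Phiq Kp Kc : ℝ) (g : ℝ → ℝ) (a : ℝ) : ℝ :=
  (∫ y in Set.Ioi (0:ℝ), Real.exp (-Phiq * y) * g (y + a)) + lam / Phiq * (Kp - Kc)

/-- `Γ₂(a) = lim_{b→∞} Γ(a,b)/Θ(b-a)`. -/
def Gam2 (Phiql : ℝ) (g : ℝ → ℝ) (a : ℝ) : ℝ :=
  ∫ y in Set.Ioi (0:ℝ), Real.exp (-Phiql * y) * g (y + a)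

/-- `Θ(x) = Θ^{(q+λ)}(x, Φ(q))`. -/
def Theta (lam Phiq : ℝ) (W : ℝ → ℝ) (x : ℝ) : ℝ :=
  1 + lam * (∫ y in (0:ℝ)..x, Real.exp (-Phiq * y) * W y)

/-- `γ(a,b) = -ρ_a(b) + K_p - K_c`. -/
def gam (Kp Kc : ℝ) (W g : ℝ → ℝ) (a b : ℝ) : ℝ :=
  -(rho W g a b) + Kp - Kc

/-- `Z(x) = Z^{(q+λ)}(x) = 1 + (q+λ)∫₀^{x ∨ 0} W(y) dy`. -/
def Zfun (q lam : ℝ) (W : ℝ → ℝ) (x : ℝ) : ℝ :=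
  1 + (q + lam) * (∫ y in (0:ℝ)..(max x 0), W y)

/-- Second scale function `Ẑ(x) = Z^{(q+λ)}(x, Φ(q))`. -/
def Zhat (lam Phiq : ℝ) (W : ℝ → ℝ) (x : ℝ) : ℝ :=
  Real.exp (Phiq * x) *
    (1 + lam * (∫ z in (0:ℝ)..(max x 0), Real.exp (-Phiq * z) * W z))

theorem monotone_of_hasDerivWithinAt_Ici {f f' : ℝ → ℝ} (hf : ConvexOn ℝ univ f)
    (hf' : ∀ x, HasDerivWithinAt f (f' x) (Ici x) x) : Monotone f' := by
  have h : f' = fun x ↦ derivWithin f (Ioi x) x := funext fun x ↦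
    (((hf' x).mono Ioi_subset_Ici_self).derivWithin (uniqueDiffWithinAt_Ioi x)).symm
  rw [h, ← monotoneOn_univ]
  simpa using hf.monotoneOn_rightDeriv

theorem isBigO_const_exp (k : ℝ) {b : ℝ} (hb : 0 < b) :
    (fun _ : ℝ ↦ k) =O[atTop] fun x ↦ exp (b * x) :=
  (Asymptotics.isLittleO_const_left.2 (Or.inr (tendsto_norm_atTop_atTop.comp
    (tendsto_exp_atTop.comp (tendsto_id.const_mul_atTop hb))))).isBigO

/-- The right derivative of a convex function of polynomial growth has subexponential growth. -/
theorem isBigO_exp_of_hasDerivWithinAt_Ici {f f' : ℝ → ℝ} (hf : ConvexOn ℝ univ f)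
    (hf' : ∀ x, HasDerivWithinAt f (f' x) (Ici x) x) {N : ℕ}
    (hN : f =O[atTop] fun x ↦ x ^ N) {b : ℝ} (hb : 0 < b) :
    f' =O[atTop] fun x ↦ exp (b * x) := by
  have hexp : f =O[atTop] fun x ↦ exp (b * x) :=
    hN.trans (isLittleO_pow_exp_pos_mul_atTop N hb).isBigO
  have hshift : (fun x ↦ f (x + 1)) =O[atTop] fun x ↦ exp (b * x) := by
    refine (hexp.comp_tendsto (tendsto_atTop_add_const_right atTop 1 tendsto_id)).trans ?_
    refine Asymptotics.IsBigO.of_bound (exp b) (Eventually.of_forall fun x ↦ ?_)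
    simp only [Function.comp_apply, id_eq, norm_eq_abs, abs_exp, ← exp_add]
    exact exp_le_exp.2 (by linarith)
  have hconst : (fun _ : ℝ ↦ f' 0) =O[atTop] fun x ↦ exp (b * x) :=
    isBigO_const_exp _ hb
  refine Asymptotics.IsBigO.trans ?_ ((hshift.norm_left.add hexp.norm_left).add hconst.norm_left)
  refine Asymptotics.IsBigO.of_bound 1 ?_
  filter_upwards [eventually_ge_atTop 0] with x hx
  have hlow : f' 0 ≤ f' x := monotone_of_hasDerivWithinAt_Ici hf hf' hx
  have hup : f' x ≤ f (x + 1) - f x := by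
    simpa [slope_def_field] using hf.le_slope_of_hasDerivWithinAt_Ioi (mem_univ x)
      (mem_univ (x + 1)) (lt_add_one x) ((hf' x).mono Ioi_subset_Ici_self)
  simp only [norm_eq_abs, one_mul]
  refine le_trans (abs_le.2 ⟨?_, ?_⟩) (le_abs_self _)
  · linarith [neg_abs_le (f' 0), abs_nonneg (f x), abs_nonneg (f (x + 1))]
  · linarith [le_abs_self (f (x + 1)), neg_abs_le (f x), abs_nonneg (f' 0)]

theorem integrableOn_exp_mul_of_monotone {g : ℝ → ℝ} (hg : Monotone g) {b c : ℝ} (hbc : b < c)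
    (hO : g =O[atTop] fun x ↦ exp (b * x)) (a : ℝ) :
    IntegrableOn (fun x ↦ exp (-c * x) * g x) (Ioi a) := by
  have hloc : LocallyIntegrable (fun x ↦ exp (-c * x) * g x) volume := by
    rw [locallyIntegrable_iff]
    intro k hk
    exact (hg.locallyIntegrable.integrableOn_isCompact hk).continuousOn_mul
      (by fun_prop : Continuous fun x : ℝ ↦ exp (-c * x)).continuousOn hk
  refine ((hloc.locallyIntegrableOn (Ici a)).integrableOn_of_isBigO_atTop
    (g := fun x ↦ exp (-(c - b) * x)) ?_
    ⟨Ioi a, Ioi_mem_atTop a, exp_neg_integrableOn_Ioi a (sub_pos.2 hbc)⟩).mono_set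
    Ioi_subset_Ici_self
  refine ((Asymptotics.isBigO_refl (fun x ↦ exp (-c * x)) atTop).mul hO).congr_right fun x ↦ ?_
  rw [← exp_add]
  ring_nf

theorem setIntegral_exp_mul_comp_add_right (g : ℝ → ℝ) (c a : ℝ) :
    ∫ y in Ioi (0 : ℝ), exp (-c * y) * g (y + a) =
      exp (c * a) * ∫ x in Ioi a, exp (-c * x) * g x := by
  have h := (measurePreserving_add_right volume a).setIntegral_preimage_emb
    (measurableEmbedding_addRight a) (fun x ↦ exp (-c * x) * g x) (Ioi a)
  rw [← h, ← integral_const_mul]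
  simp only [preimage_add_const_Ioi, sub_self]
  refine integral_congr_ae (Eventually.of_forall fun y ↦ ?_)
  simp only [← mul_assoc, ← exp_add]
  ring_nf

theorem setIntegral_exp_neg_mul_Ioi {c : ℝ} (hc : 0 < c) (a : ℝ) :
    ∫ x in Ioi a, exp (-c * x) = exp (-c * a) / c := by
  rw [integral_exp_mul_Ioi (neg_lt_zero.2 hc), neg_div_neg_eq]

theorem continuous_setIntegral_Ioi {h : ℝ → ℝ} (hh : ∀ a, IntegrableOn h (Ioi a)) :
    Continuous fun a ↦ ∫ x in Ioi a, h x := by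
  have hint : ∀ a b, IntervalIntegrable h volume a b := fun a b ↦
    ⟨(hh a).mono_set Ioc_subset_Ioi_self, (hh b).mono_set Ioc_subset_Ioi_self⟩
  have : (fun a ↦ ∫ x in Ioi a, h x) = fun a ↦ (∫ x in Ioi 0, h x) - ∫ x in (0 : ℝ)..a, h x := by
    funext a
    rw [← intervalIntegral.integral_interval_add_Ioi (hh 0) (hh a)]
    ring
  rw [this]
  exact continuous_const.sub (intervalIntegral.continuous_primitive hint 0)

theorem continuous_setIntegral_exp_mul_comp_add {g : ℝ → ℝ} {c : ℝ}
    (hi : ∀ a, IntegrableOn (fun x ↦ exp (-c * x) * g x) (Ioi a)) :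
    Continuous fun a ↦ ∫ y in Ioi (0 : ℝ), exp (-c * y) * g (y + a) := by
  simp only [setIntegral_exp_mul_comp_add_right]
  exact (by fun_prop : Continuous fun a : ℝ ↦ exp (c * a)).mul (continuous_setIntegral_Ioi hi)

theorem setIntegral_exp_mul_comp_add_pos {g : ℝ → ℝ} {c : ℝ} (hc : 0 < c) (hg : Monotone g)
    (hi : ∀ a, IntegrableOn (fun x ↦ exp (-c * x) * g x) (Ioi a)) {a b : ℝ}
    (ha : ∀ x, a < x → 0 ≤ g x) (hab : a ≤ b) (hb : 0 < g b) :
    0 < ∫ y in Ioi (0 : ℝ), exp (-c * y) * g (y + a) := by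
  rw [setIntegral_exp_mul_comp_add_right]
  refine mul_pos (exp_pos _) ?_
  calc (0 : ℝ) < (exp (-c * b) / c) * g b := by positivity
    _ = ∫ x in Ioi b, exp (-c * x) * g b := by
      rw [integral_mul_const, setIntegral_exp_neg_mul_Ioi hc]
    _ ≤ ∫ x in Ioi b, exp (-c * x) * g x :=
      setIntegral_mono_on ((exp_neg_integrableOn_Ioi b hc).mul_const _) (hi b) measurableSet_Ioi
        fun x hx ↦ mul_le_mul_of_nonneg_left (hg (le_of_lt hx)) (exp_pos _).le
    _ ≤ ∫ x in Ioi a, exp (-c * x) * g x := by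
      refine setIntegral_mono_set (hi a) ?_ (Ioi_subset_Ioi hab).eventuallyLE
      filter_upwards [ae_restrict_mem measurableSet_Ioi] with x hx
      exact mul_nonneg (exp_pos _).le (ha x hx)

theorem le_setIntegral_exp_mul_comp_add {g : ℝ → ℝ} {c : ℝ} (hc : 0 < c)
    (hi : ∀ a, IntegrableOn (fun x ↦ exp (-c * x) * g x) (Ioi a)) {a m : ℝ}
    (ha : ∀ x, a < x → m ≤ g x) :
    m / c ≤ ∫ y in Ioi (0 : ℝ), exp (-c * y) * g (y + a) := by
  rw [setIntegral_exp_mul_comp_add_right]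
  have h : (exp (-c * a) / c) * m ≤ ∫ x in Ioi a, exp (-c * x) * g x := by
    rw [← setIntegral_exp_neg_mul_Ioi hc, ← integral_mul_const]
    exact setIntegral_mono_on ((exp_neg_integrableOn_Ioi a hc).mul_const _) (hi a)
      measurableSet_Ioi fun x hx ↦ mul_le_mul_of_nonneg_left (ha x hx) (exp_pos _).le
  refine le_trans (le_of_eq ?_) (mul_le_mul_of_nonneg_left h (exp_pos (c * a)).le)
  rw [← mul_assoc, ← mul_div_assoc, ← exp_add]
  simp [div_eq_inv_mul]

/-- The Laplace-type transform is nonnegative only on a set bounded below when `g` is eventually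
negative at `-∞`. -/
theorem bddBelow_setIntegral_exp_mul_comp_add {g : ℝ → ℝ} {c : ℝ} (hc : 0 < c) (hg : Monotone g)
    (hi : ∀ a, IntegrableOn (fun x ↦ exp (-c * x) * g x) (Ioi a)) {b : ℝ} (hb : g b < 0) :
    BddBelow {a | 0 ≤ ∫ y in Ioi (0 : ℝ), exp (-c * y) * g (y + a)} := by
  set C := ∫ x in Ioi b, exp (-c * x) * (g x - g b) with hC
  have hbound : ∀ a ≤ b, ∫ x in Ioi a, exp (-c * x) * g x ≤ exp (-c * a) / c * g b + C := by
    intro a hab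
    have hie (t : ℝ) : IntegrableOn (fun x ↦ exp (-c * x) * g b) (Ioi t) :=
      (exp_neg_integrableOn_Ioi t hc).mul_const (g b)
    have hle : ∫ x in Ioc a b, exp (-c * x) * g x ≤ ∫ x in Ioc a b, exp (-c * x) * g b :=
      setIntegral_mono_on ((hi a).mono_set Ioc_subset_Ioi_self)
        ((hie a).mono_set Ioc_subset_Ioi_self) measurableSet_Ioc
        fun x hx ↦ mul_le_mul_of_nonneg_left (hg hx.2) (exp_pos _).le
    have h₁ := intervalIntegral.integral_interval_add_Ioi (hi a) (hi b)
    have h₂ := intervalIntegral.integral_interval_add_Ioi (hie a) (hie b)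
    have h₃ : C = (∫ x in Ioi b, exp (-c * x) * g x) - ∫ x in Ioi b, exp (-c * x) * g b := by
      rw [hC, ← integral_sub (hi b) (hie b)]
      simp only [mul_sub]
    rw [intervalIntegral.integral_of_le hab] at h₁ h₂
    have h₄ : ∫ x in Ioi a, exp (-c * x) * g b = exp (-c * a) / c * g b := by
      rw [integral_mul_const, setIntegral_exp_neg_mul_Ioi hc]
    linarith
  have hlim : Tendsto (fun a ↦ exp (-c * a) / c * g b + C) atBot atBot := by
    refine tendsto_atBot_add_const_right _ _ (Tendsto.atTop_mul_const_of_neg hb ?_)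
    refine Tendsto.atTop_div_const hc (tendsto_exp_atTop.comp ?_)
    exact tendsto_id.const_mul_atBot_of_neg (neg_lt_zero.2 hc)
  obtain ⟨t, ht⟩ := eventually_atBot.1 ((hlim.eventually_lt_atBot 0).and (eventually_le_atBot b))
  refine ⟨t, fun a ha ↦ ?_⟩
  by_contra! hat
  have hneg := (hbound a (ht a hat.le).2).trans_lt (ht a hat.le).1
  rw [mem_ofPred_eq, setIntegral_exp_mul_comp_add_right] at ha
  exact absurd ha (not_le.2 (mul_neg_of_pos_of_neg (exp_pos _) hneg))

theorem csInf_nonneg_lt_of_continuousAt {F : ℝ → ℝ} {m : ℝ} (hF : ContinuousAt F m) (hm : 0 < F m)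
    (hb : BddBelow {a | 0 ≤ F a}) : sInf {a | 0 ≤ F a} < m := by
  obtain ⟨a, hpos, ham⟩ := (((hF.eventually_const_lt hm).filter_mono nhdsWithin_le_nhds).and
    (self_mem_nhdsWithin (s := Iio m))).exists
  exact (csInf_le hb hpos.le).trans_lt ham

/-- Lemma 5.2 (bounds for the left inverses of Γ₁ and Γ₂) of the paper. -/
theorem bounds_for_a_underline
    (q lam Phiq Phiql : ℝ) (hq : 0 < q) (hlam : 0 < lam)
    (hPhiq : 0 < Phiq) (hPhi : Phiq < Phiql)
    (f f' : ℝ → ℝ)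
    (hf_conv : ConvexOn ℝ Set.univ f)
    (hf_deriv : ∀ x : ℝ, HasDerivWithinAt f (f' x) (Set.Ici x) x)
    (hf_pw : ∃ E : Set ℝ, E.Countable ∧ ∀ x ∉ E, ContinuousAt f' x)
    (hf_growth : ∃ C M : ℝ, ∃ N : ℕ, 0 < C ∧ 0 < M ∧
      ∀ x : ℝ, M < |x| → |f x| ≤ C * |x| ^ N)
    (Kc Kp : ℝ) (hK : Kp < Kc)
    (g : ℝ → ℝ) (hg : ∀ x : ℝ, g x = f' x + q * Kc + lam * (Kc - Kp))
    (habar_ne : {a : ℝ | 0 ≤ g a}.Nonempty)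
    (habar_bdd : BddBelow {a : ℝ | 0 ≤ g a})
    (habb_ne : {a : ℝ | 0 < f' a + q * Kp}.Nonempty)
    (habb_bdd : BddBelow {a : ℝ | 0 < f' a + q * Kp})
    (abar abarbar : ℝ)
    (habar : abar = sInf {a : ℝ | 0 ≤ g a})
    (habarbar : abarbar = sInf {a : ℝ | 0 < f' a + q * Kp}) :
    ({a : ℝ | 0 ≤ Gam1 lam Phiq Kp Kc g a}.Nonempty ∧
      BddBelow {a : ℝ | 0 ≤ Gam1 lam Phiq Kp Kc g a} ∧
      sInf {a : ℝ | 0 ≤ Gam1 lam Phiq Kp Kc g a} < abarbar) ∧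
    ({a : ℝ | 0 ≤ Gam2 Phiql g a}.Nonempty ∧
      BddBelow {a : ℝ | 0 ≤ Gam2 Phiql g a} ∧
      sInf {a : ℝ | 0 ≤ Gam2 Phiql g a} < abar) := by
  have hf'_mono := monotone_of_hasDerivWithinAt_Ici hf_conv hf_deriv
  have hg_mono : Monotone g := fun x y hxy ↦ by
    rw [hg, hg]
    linarith [hf'_mono hxy]
  have hg_bigO : g =O[atTop] fun x ↦ exp (Phiq / 2 * x) := by
    obtain ⟨C, M, N, -, -, hM⟩ := hf_growth
    have hN : f =O[atTop] fun x ↦ x ^ N := by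
      refine Asymptotics.IsBigO.of_bound C ?_
      filter_upwards [eventually_gt_atTop M] with x hx
      simpa using hM x (hx.trans_le (le_abs_self x))
    have hconst : (fun _ : ℝ ↦ q * Kc + lam * (Kc - Kp)) =O[atTop]
        fun x ↦ exp (Phiq / 2 * x) :=
      isBigO_const_exp _ (half_pos hPhiq)
    refine ((isBigO_exp_of_hasDerivWithinAt_Ici hf_conv hf_deriv hN
      (half_pos hPhiq)).add hconst).congr_left fun x ↦ ?_
    rw [hg]
    ring
  have hi₁ := integrableOn_exp_mul_of_monotone hg_mono (half_lt_self hPhiq) hg_bigO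
  have hi₂ := integrableOn_exp_mul_of_monotone hg_mono ((half_lt_self hPhiq).trans hPhi) hg_bigO
  have hPhiql : 0 < Phiql := hPhiq.trans hPhi
  have hK' : 0 < Kc - Kp := sub_pos.2 hK
  have hqK : 0 < q * (Kc - Kp) := mul_pos hq hK'
  have hlamK : 0 < lam * (Kc - Kp) := mul_pos hlam hK'
  obtain ⟨b, hb⟩ : ∃ b, g b < 0 := by
    by_contra! h
    exact not_bddBelow_univ (habar_bdd.mono fun x _ ↦ h x)
  have hbdd₁ : BddBelow {a : ℝ | 0 ≤ Gam1 lam Phiq Kp Kc g a} := by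
    refine (bddBelow_setIntegral_exp_mul_comp_add hPhiq hg_mono hi₁ hb).mono fun a ha ↦ ?_
    have hneg : lam / Phiq * (Kp - Kc) ≤ 0 :=
      mul_nonpos_of_nonneg_of_nonpos (div_pos hlam hPhiq).le (by linarith)
    simp only [mem_ofPred_eq, Gam1] at ha ⊢
    linarith
  have hbdd₂ : BddBelow {a : ℝ | 0 ≤ Gam2 Phiql g a} :=
    bddBelow_setIntegral_exp_mul_comp_add hPhiql hg_mono hi₂ hb
  have hpos₁ : 0 < Gam1 lam Phiq Kp Kc g abarbar := by
    have hle : (q + lam) * (Kc - Kp) / Phiq ≤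
        ∫ y in Ioi (0 : ℝ), exp (-Phiq * y) * g (y + abarbar) := by
      refine le_setIntegral_exp_mul_comp_add hPhiq hi₁ fun x hx ↦ ?_
      obtain ⟨z, hz, hzx⟩ := exists_lt_of_csInf_lt habb_ne (habarbar ▸ hx)
      have hz' : 0 < f' z + q * Kp := hz
      rw [hg]
      linarith [hf'_mono hzx.le]
    have heq : (q + lam) * (Kc - Kp) / Phiq + lam / Phiq * (Kp - Kc) = q * (Kc - Kp) / Phiq := by
      ring
    have := div_pos hqK hPhiq
    rw [Gam1]
    linarith
  have hpos₂ : 0 < Gam2 Phiql g abar := by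
    obtain ⟨z, hz⟩ := habb_ne
    have hgz : 0 < g z := by
      have hz' : 0 < f' z + q * Kp := hz
      rw [hg]
      linarith
    refine setIntegral_exp_mul_comp_add_pos hPhiql hg_mono hi₂ (fun x hx ↦ ?_)
      (habar ▸ csInf_le habar_bdd hgz.le) hgz
    obtain ⟨y, hy, hyx⟩ := exists_lt_of_csInf_lt habar_ne (habar ▸ hx)
    exact le_trans hy (hg_mono hyx.le)
  refine ⟨⟨⟨abarbar, hpos₁.le⟩, hbdd₁, csInf_nonneg_lt_of_continuousAt ?_ hpos₁ hbdd₁⟩,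
    ⟨⟨abar, hpos₂.le⟩, hbdd₂, csInf_nonneg_lt_of_continuousAt ?_ hpos₂ hbdd₂⟩⟩
  · exact ((continuous_setIntegral_exp_mul_comp_add hi₁).add continuous_const).continuousAt
  · exact (continuous_setIntegral_exp_mul_comp_add hi₂).continuousAt
end
end
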